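/- Let G be a hyperbolic group with finite generating set A and let φ be an endomorphism of G with Gφ ≠ {1}. If the kernel of φ is finite and the image subgroup Gφ is a quasiconvex subgroup of G with respect to A, then φ is a quasi-isometric embedding of (G,d_A) into itself: there exist λ ≥ 1 and K ≥ 0 such that (1/λ)d_A(g,h) − K ≤ d_A(gφ,hφ) ≤ λd_A(g,h) + K for all g,h ∈ G. -/

import Mathlib

open scoped Classical

section Defs

variable {G : Type*}

/-- Word length of `g` with respect to a generating set `A`: the least `n` such that
`g` is a product of `n` elements of `A ∪ A⁻¹`. -/
noncomputable def wordLength [Group G] (A : Set G) (g : G) : ℕ :=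
  sInf {n : ℕ | ∃ w : List G, w.length = n ∧ (∀ x ∈ w, x ∈ A ∨ x⁻¹ ∈ A) ∧ w.prod = g}

/-- The word metric `d_A(g,h)` (as a real number). -/
noncomputable def wordDist [Group G] (A : Set G) (g h : G) : ℝ :=
  (wordLength A (g⁻¹ * h) : ℝ)

/-- The Gromov product `(x|y)_p` with respect to a distance function `d`. -/
noncomputable def gromov {X : Type*} (d : X → X → ℝ) (p x y : X) : ℝ :=
  (d p x + d p y - d x y) / 2

/-- `G` is `δ`-hyperbolic with respect to the generating set `A`. -/
def IsHyperbolicWith [Group G] (A : Set G) (δ : ℝ) : Prop :=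
  ∀ p g₀ g₁ g₂ : G,
    min (gromov (wordDist A) p g₀ g₁) (gromov (wordDist A) p g₁ g₂) - δ ≤
      gromov (wordDist A) p g₀ g₂

/-- `G` is hyperbolic with respect to the generating set `A`. -/
def IsHyperbolic [Group G] (A : Set G) : Prop :=
  ∃ δ : ℝ, 0 ≤ δ ∧ IsHyperbolicWith A δ

/-- `ρ_{p,γ}(g,h) = e^{-γ (g|h)_p}` (and `0` on the diagonal), with respect to a
distance function `dA`. -/
noncomputable def visualRhoOf {X : Type*} (dA : X → X → ℝ) (p : X) (γ : ℝ) (g h : X) : ℝ :=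
  if g = h then 0 else Real.exp (-γ * gromov dA p g h)

/-- `d` is a metric on `X`. -/
structure IsMetric {X : Type*} (d : X → X → ℝ) : Prop where
  refl : ∀ x, d x x = 0
  eq_of : ∀ x y, d x y = 0 → x = y
  symm : ∀ x y, d x y = d y x
  triangle : ∀ x y z, d x z ≤ d x y + d y z

/-- `d` is a visual metric in `V(p,γ,T)` with respect to the distance function `dA`. -/
def InVisualOf {X : Type*} (dA : X → X → ℝ) (p : X) (γ T : ℝ) (d : X → X → ℝ) : Prop :=
  IsMetric d ∧ ∀ g h : X, g ≠ h →
    visualRhoOf dA p γ g h / T ≤ d g h ∧ d g h ≤ T * visualRhoOf dA p γ g h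

/-- `d ∈ V^A(p,γ,T)`: `d` is a visual metric with respect to the word metric `d_A`. -/
def InVisual [Group G] (A : Set G) (p : G) (γ T : ℝ) (d : G → G → ℝ) : Prop :=
  InVisualOf (wordDist A) p γ T d

/-- `φ : (X,d) → (X,d')` satisfies a Hölder condition of exponent `r`. -/
def HolderCondWith {X : Type*} (d d' : X → X → ℝ) (φ : X → X) (r : ℝ) : Prop :=
  ∃ K : ℝ, 0 < K ∧ ∀ g h : X, d' (φ g) (φ h) ≤ K * d g h ^ r

/-- `φ : (X,d) → (X,d')` satisfies a Hölder condition (of some positive exponent). -/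
def SatisfiesHolder {X : Type*} (d d' : X → X → ℝ) (φ : X → X) : Prop :=
  ∃ r : ℝ, 0 < r ∧ HolderCondWith d d' φ r

/-- `φ : (X,d) → (X,d')` satisfies a Lipschitz condition. -/
def LipschitzCond {X : Type*} (d d' : X → X → ℝ) (φ : X → X) : Prop :=
  ∃ K : ℝ, 0 < K ∧ ∀ g h : X, d' (φ g) (φ h) ≤ K * d g h

/-- `φ : (X,d) → (X,d')` is uniformly continuous. -/
def UnifCont {X : Type*} (d d' : X → X → ℝ) (φ : X → X) : Prop :=
  ∀ ε : ℝ, 0 < ε → ∃ δ : ℝ, 0 < δ ∧ ∀ g h : X, d g h < δ → d' (φ g) (φ h) < ε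

/-- `φ : (X,d) → (X,d')` is a quasi-isometric embedding. -/
def QIEmbedding {X : Type*} (d d' : X → X → ℝ) (φ : X → X) : Prop :=
  ∃ lam K : ℝ, 1 ≤ lam ∧ 0 ≤ K ∧ ∀ g h : X,
    (1 / lam) * d g h - K ≤ d' (φ g) (φ h) ∧ d' (φ g) (φ h) ≤ lam * d g h + K

/-- `H` is a quasiconvex subset of `G` with respect to the generating set `A`:
every geodesic word-metric chain joining two points of `H` stays at bounded
distance from `H`. -/
def IsQuasiconvex [Group G] (A : Set G) (H : Set G) : Prop :=
  ∃ q : ℝ, 0 ≤ q ∧ ∀ h ∈ H, ∀ h' ∈ H, ∀ n : ℕ, ∀ g : ℕ → G,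
    g 0 = h → g n = h' → (n : ℝ) = wordDist A h h' →
    (∀ i < n, wordDist A (g i) (g (i + 1)) = 1) →
    ∀ i ≤ n, ∃ z ∈ H, wordDist A (g i) z ≤ q

end Defs

section WordLength

variable {G : Type*} [Group G] {A : Set G}

theorem wordLength_prod_le (w : List G) (hw : ∀ x ∈ w, x ∈ A ∨ x⁻¹ ∈ A) :
    wordLength A w.prod ≤ w.length :=
  Nat.sInf_le ⟨w, rfl, hw, rfl⟩

theorem exists_word_of_closure_eq_top (hA : Subgroup.closure A = ⊤) (g : G) :
    ∃ w : List G, w.length = wordLength A g ∧ (∀ x ∈ w, x ∈ A ∨ x⁻¹ ∈ A) ∧ w.prod = g := by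
  have hg : g ∈ Submonoid.closure (A ∪ A⁻¹) := by
    rw [← Subgroup.closure_toSubmonoid, hA]
    exact Subgroup.mem_top g
  obtain ⟨w, hw, hwg⟩ := Submonoid.exists_list_of_mem_closure hg
  exact Nat.sInf_mem
    (s := {n : ℕ | ∃ w : List G, w.length = n ∧ (∀ x ∈ w, x ∈ A ∨ x⁻¹ ∈ A) ∧ w.prod = g})
    ⟨w.length, w, rfl, hw, hwg⟩

theorem wordLength_mul_le (hA : Subgroup.closure A = ⊤) (g h : G) :
    wordLength A (g * h) ≤ wordLength A g + wordLength A h := by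
  obtain ⟨v, hvl, hv, rfl⟩ := exists_word_of_closure_eq_top hA g
  obtain ⟨w, hwl, hw, rfl⟩ := exists_word_of_closure_eq_top hA h
  rw [← hvl, ← hwl, ← List.prod_append, ← List.length_append]
  exact wordLength_prod_le _ fun x hx => (List.mem_append.1 hx).elim (hv x) (hw x)

theorem wordLength_inv_le (hA : Subgroup.closure A = ⊤) (g : G) :
    wordLength A g⁻¹ ≤ wordLength A g := by
  obtain ⟨w, hwl, hw, rfl⟩ := exists_word_of_closure_eq_top hA g
  rw [← hwl, List.prod_inv_reverse]
  refine (wordLength_prod_le _ fun x hx => ?_).trans (by simp)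
  simp only [List.mem_reverse, List.mem_map] at hx
  obtain ⟨y, hy, rfl⟩ := hx
  simpa using (hw y hy).symm

theorem finite_setOf_wordLength_le (hfin : A.Finite) (hA : Subgroup.closure A = ⊤) (n : ℕ) :
    {g : G | wordLength A g ≤ n}.Finite := by
  have hS : (A ∪ A⁻¹).Finite := hfin.union hfin.inv
  have : Finite ↥(A ∪ A⁻¹) := hS
  refine ((List.finite_length_le (↥(A ∪ A⁻¹)) n).image
    fun l => (l.map Subtype.val).prod).subset fun g hg => ?_
  obtain ⟨w, hwl, hw, rfl⟩ := exists_word_of_closure_eq_top hA g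
  lift w to List ↥(A ∪ A⁻¹) using hw
  refine ⟨w, ?_, rfl⟩
  rw [List.length_map] at hwl
  exact hwl.trans_le hg

theorem exists_wordLength_map_le (hfin : A.Finite) (hA : Subgroup.closure A = ⊤) (φ : G →* G) :
    ∃ M : ℕ, ∀ g, wordLength A (φ g) ≤ M * wordLength A g := by
  obtain ⟨M, hM⟩ := (hfin.image fun a => wordLength A (φ a)).bddAbove
  refine ⟨M, fun g => ?_⟩
  have hgen : ∀ x, x ∈ A ∨ x⁻¹ ∈ A → wordLength A (φ x) ≤ M := by
    rintro x (hx | hx)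
    · exact hM ⟨x, hx, rfl⟩
    · have := wordLength_inv_le hA (φ x⁻¹)
      rw [map_inv, inv_inv, ← map_inv] at this
      exact this.trans (hM ⟨_, hx, rfl⟩)
  have hword : ∀ w : List G, (∀ x ∈ w, x ∈ A ∨ x⁻¹ ∈ A) →
      wordLength A (φ w.prod) ≤ M * w.length := by
    intro w hw
    induction w with
    | nil => simpa using wordLength_prod_le (A := A) [] (by simp)
    | cons x w ih =>
      rw [List.prod_cons, map_mul, List.length_cons, mul_add_one, add_comm]
      exact (wordLength_mul_le hA _ _).trans (add_le_add (hgen x (hw x (by simp)))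
        (ih fun y hy => hw y (by simp [hy])))
  obtain ⟨w, hwl, hw, rfl⟩ := exists_word_of_closure_eq_top hA g
  rw [← hwl]
  exact hword w hw

theorem exists_wordLength_le_of_map_le (hfin : A.Finite) (hA : Subgroup.closure A = ⊤)
    (φ : G →* G) (hker : {g : G | φ g = 1}.Finite) (n : ℕ) :
    ∃ C : ℕ, ∀ g, wordLength A (φ g) ≤ n → wordLength A g ≤ C := by
  have hpre : {g : G | wordLength A (φ g) ≤ n}.Finite := by
    refine (finite_setOf_wordLength_le hfin hA n).preimage' (f := φ) fun b _ => ?_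
    by_cases hb : ∃ x, φ x = b
    · obtain ⟨x, rfl⟩ := hb
      refine (hker.image (x * ·)).subset fun y hy => ⟨x⁻¹ * y, ?_, by simp⟩
      have hy : φ y = φ x := hy
      simp [hy]
    · exact Set.finite_empty.subset fun y hy => hb ⟨y, hy⟩
  obtain ⟨C, hC⟩ := (hpre.image (wordLength A)).bddAbove
  exact ⟨C, fun g hg => hC ⟨g, hg, rfl⟩⟩

/-- Each letter of a shortest word has length exactly one. -/
theorem wordLength_getElem_of_shortest (hA : Subgroup.closure A = ⊤) {w : List G}
    (hw : ∀ x ∈ w, x ∈ A ∨ x⁻¹ ∈ A) (hmin : w.length = wordLength A w.prod)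
    {i : ℕ} (hi : i < w.length) : wordLength A w[i] = 1 := by
  have hle : wordLength A w[i] ≤ 1 := by
    simpa using wordLength_prod_le (A := A) [w[i]] (by simpa using hw _ (List.getElem_mem hi))
  have htake := wordLength_prod_le (A := A) (w.take i) fun x hx => hw x (List.mem_of_mem_take hx)
  have hdrop := wordLength_prod_le (A := A) (w.drop (i + 1))
    fun x hx => hw x (List.mem_of_mem_drop hx)
  have hprod : w.prod = (w.take i).prod * w[i] * (w.drop (i + 1)).prod := by
    rw [← List.prod_take_succ w i hi, List.prod_take_mul_prod_drop]
  have h₁ := wordLength_mul_le hA ((w.take i).prod * w[i]) (w.drop (i + 1)).prod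
  have h₂ := wordLength_mul_le hA (w.take i).prod w[i]
  rw [← hprod] at h₁
  simp only [List.length_take, List.length_drop] at htake hdrop
  omega

theorem exists_wordLength_le_mul_map_add_one (hfin : A.Finite) (hA : Subgroup.closure A = ⊤)
    (φ : G →* G) (hker : {g : G | φ g = 1}.Finite) (hqc : IsQuasiconvex A (Set.range ⇑φ)) :
    ∃ C : ℕ, ∀ g, wordLength A g ≤ C * (wordLength A (φ g) + 1) := by
  obtain ⟨q, hq, hqc⟩ := hqc
  obtain ⟨C, hC⟩ := exists_wordLength_le_of_map_le hfin hA φ hker (2 * ⌊q⌋₊ + 1)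
  refine ⟨C, fun g => ?_⟩
  obtain ⟨w, hwl, hw, hwg⟩ := exists_word_of_closure_eq_top hA (φ g)
  have hone : wordLength A (1 : G) = 0 := by
    simpa using wordLength_prod_le (A := A) [] (by simp)
  have hstep : ∀ i (hi : i < w.length),
      wordLength A ((w.take i).prod⁻¹ * (w.take (i + 1)).prod) = 1 := by
    intro i hi
    rw [List.prod_take_succ w i hi, inv_mul_cancel_left]
    exact wordLength_getElem_of_shortest hA hw (hwg ▸ hwl) hi
  have hnear : ∀ i ≤ w.length, ∃ y, wordLength A ((w.take i).prod⁻¹ * φ y) ≤ ⌊q⌋₊ := by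
    intro i hi
    obtain ⟨z, ⟨y, rfl⟩, hy⟩ := hqc 1 ⟨1, map_one φ⟩ (φ g) ⟨g, rfl⟩ w.length
      (fun i => (w.take i).prod) (by simp) (by simpa using hwg) (by simp [wordDist, hwl])
      (fun i hi => by simp [wordDist, hstep i hi]) i hi
    exact ⟨y, Nat.le_floor hy⟩
  have key : ∀ i ≤ w.length, ∀ x, wordLength A ((w.take i).prod⁻¹ * φ x) ≤ ⌊q⌋₊ →
      wordLength A x ≤ C * (i + 1) := by
    intro i
    induction i with
    | zero =>
      intro _ x hx
      have := hC x (by simp at hx; omega)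
      simpa using this
    | succ i ih =>
      intro hi x hx
      obtain ⟨y, hy⟩ := hnear i (by omega)
      have hyC := ih (by omega) y hy
      have hxy : wordLength A (y⁻¹ * x) ≤ C := by
        apply hC
        have h₁ := wordLength_inv_le hA ((w.take i).prod⁻¹ * φ y)
        have h₂ := hstep i (by omega)
        have h₃ := wordLength_mul_le hA (((w.take i).prod⁻¹ * φ y)⁻¹ *
          ((w.take i).prod⁻¹ * (w.take (i + 1)).prod)) ((w.take (i + 1)).prod⁻¹ * φ x)
        have h₄ := wordLength_mul_le hA ((w.take i).prod⁻¹ * φ y)⁻¹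
          ((w.take i).prod⁻¹ * (w.take (i + 1)).prod)
        have heq : φ (y⁻¹ * x) = ((w.take i).prod⁻¹ * φ y)⁻¹ *
          ((w.take i).prod⁻¹ * (w.take (i + 1)).prod) * ((w.take (i + 1)).prod⁻¹ * φ x) := by
          rw [map_mul, map_inv]
          group
        rw [heq]
        omega
      have := wordLength_mul_le hA y (y⁻¹ * x)
      rw [mul_inv_cancel_left] at this
      rw [mul_add_one]
      omega
  rw [← hwl]
  exact key w.length le_rfl g (by simp [hwg, hone])

end WordLength

/-- A nontrivial endomorphism of a hyperbolic group with finite kernel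
and quasiconvex image is a quasi-isometric embedding of `(G,d_A)` into itself. -/
theorem stmt_8 {G : Type*} [Group G] (A : Set G)
    (hAfin : A.Finite) (hAgen : Subgroup.closure A = ⊤) (hhyp : IsHyperbolic A)
    (φ : G →* G) (hnt : ∃ g : G, φ g ≠ 1)
    (hker : {g : G | φ g = 1}.Finite)
    (hqc : IsQuasiconvex A (Set.range ⇑φ)) :
    QIEmbedding (wordDist A) (wordDist A) ⇑φ := by
  obtain ⟨M, hM⟩ := exists_wordLength_map_le hAfin hAgen φ
  obtain ⟨C, hC⟩ := exists_wordLength_le_mul_map_add_one hAfin hAgen φ hker hqc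
  have hlam : (0 : ℝ) < M + C + 1 := by positivity
  refine ⟨M + C + 1, 1, le_add_of_nonneg_left (by positivity), zero_le_one, fun g h => ?_⟩
  have hmap : (φ g)⁻¹ * φ h = φ (g⁻¹ * h) := by simp
  have h₁ : (wordLength A (φ (g⁻¹ * h)) : ℝ) ≤ M * wordLength A (g⁻¹ * h) :=
    mod_cast hM (g⁻¹ * h)
  have h₂ : (wordLength A (g⁻¹ * h) : ℝ) ≤ C * (wordLength A (φ (g⁻¹ * h)) + 1) :=
    mod_cast hC (g⁻¹ * h)
  simp only [wordDist, hmap]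
  constructor
  · rw [sub_le_iff_le_add, one_div, inv_mul_le_iff₀ hlam]
    refine h₂.trans ?_
    gcongr
    linarith [(Nat.cast_nonneg M : (0 : ℝ) ≤ M)]
  · refine (h₁.trans ?_).trans (le_add_of_nonneg_right zero_le_one)
    gcongr
    linarith [(Nat.cast_nonneg C : (0 : ℝ) ≤ C)]
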